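/- The Riemannian manifold (ℝ_{>0}×ℝ, g) with g = 4dx² + x^{-6}dy² is geodesically convex: any two points can be joined by a geodesic, and this geodesic is unique. -/

import Mathlib

open Real Set

noncomputable section

/-- A geodesic segment of g = 4dx² + x⁻⁶dy², parameterized on [0,1]. -/
def GeodSeg (γ : ℝ → ℝ × ℝ) : Prop :=
  ContDiff ℝ 2 γ ∧
  (∀ t ∈ Set.Icc (0 : ℝ) 1, 0 < (γ t).1) ∧
  (∀ t ∈ Set.Icc (0 : ℝ) 1,
    deriv (deriv (fun s => (γ s).1)) t =
        -(3 / 4) * ((γ t).1) ^ (-7 : ℤ) * (deriv (fun s => (γ s).2) t) ^ 2 ∧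
    deriv (deriv (fun s => (γ s).2)) t =
        6 * ((γ t).1)⁻¹ * deriv (fun s => (γ s).1) t * deriv (fun s => (γ s).2) t)

/-- lower growth bound from a lower derivative bound -/
lemma aux_lower {f f' : ℝ → ℝ} {a b c : ℝ}
    (hf : ∀ t ∈ Icc a b, HasDerivWithinAt f (f' t) (Icc a b) t)
    (hc : ∀ t ∈ Icc a b, c ≤ f' t) {t : ℝ} (ht : t ∈ Icc a b) : c * (t - a) ≤ f t - f a := by
  have h1 : ∀ t ∈ Icc a b, HasDerivWithinAt (fun t => f t - c * t) (f' t - c * 1) (Icc a b) t :=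
    fun t ht => (hf t ht).sub ((hasDerivWithinAt_id t _).const_mul c)
  have h2 : MonotoneOn (fun t => f t - c * t) (Icc a b) := by
    refine monotoneOn_of_hasDerivWithinAt_nonneg (f' := fun t => f' t - c * 1) (convex_Icc a b)
      (fun t ht => (h1 t ht).continuousWithinAt)
      (fun t ht => (h1 t (interior_subset ht)).mono interior_subset) ?_
    intro t ht
    have := hc t (interior_subset ht)
    linarith
  have h3 := h2 (left_mem_Icc.2 (ht.1.trans ht.2)) ht ht.1
  simp only at h3
  linarith

lemma aux_upper {f f' : ℝ → ℝ} {a b c : ℝ}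
    (hf : ∀ t ∈ Icc a b, HasDerivWithinAt f (f' t) (Icc a b) t)
    (hc : ∀ t ∈ Icc a b, f' t ≤ c) {t : ℝ} (ht : t ∈ Icc a b) : f t - f a ≤ c * (t - a) := by
  have := aux_lower (f := fun t => - f t) (f' := fun t => - f' t) (c := -c)
    (fun t ht => (hf t ht).neg) (fun t ht => neg_le_neg (hc t ht)) ht
  linarith

lemma aux_eq {f g f' : ℝ → ℝ} {a b : ℝ}
    (hf : ∀ t ∈ Icc a b, HasDerivWithinAt f (f' t) (Icc a b) t)
    (hg : ∀ t ∈ Icc a b, HasDerivWithinAt g (f' t) (Icc a b) t) (h0 : f a = g a)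
    {t : ℝ} (ht : t ∈ Icc a b) : f t = g t := by
  have h : ∀ t ∈ Icc a b, HasDerivWithinAt (fun t => f t - g t) (f' t - f' t) (Icc a b) t :=
    fun t ht => (hf t ht).sub (hg t ht)
  have h1 := aux_lower (c := 0) h (by simp) ht
  have h2 := aux_upper (c := 0) h (by simp) ht
  linarith

lemma aux_ftc {W : ℝ → ℝ} (hW : Continuous W) (a c t : ℝ) :
    HasDerivAt (fun u => c + ∫ s in a..u, W s) (W t) t :=
  (intervalIntegral.integral_hasDerivAt_right (hW.intervalIntegrable _ _)
    (hW.stronglyMeasurableAtFilter _ _) hW.continuousAt).const_add c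

/-- Shooting: solution of the Dirichlet problem for a bounded nonpositive Lipschitz
right-hand side. -/
lemma bvp_exists {g : ℝ → ℝ} {K : NNReal} (hg : LipschitzWith K g) {M : ℝ}
    (hgM : ∀ z, -M ≤ g z) (hg0 : ∀ z, g z ≤ 0) {y0 y1 : ℝ} (hy : y0 < y1) (A B : ℝ) :
    ∃ H H1 H2 : ℝ → ℝ, (∀ y, HasDerivAt H (H1 y) y) ∧ (∀ y, HasDerivAt H1 (H2 y) y) ∧
      Continuous H2 ∧ (∀ y, H2 y ≤ 0) ∧ H y0 = A ∧ H y1 = B ∧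
      ∀ y ∈ Icc y0 y1, H2 y = g (H y) := by
  have hM : 0 ≤ M := by have := hgM 0; have := hg0 0; linarith
  set T := y1 - y0 with hT
  have hT0 : 0 < T := sub_pos.2 hy
  set S : ℝ := M * T + |B - A| / T with hS
  have hS0 : 0 ≤ S := by positivity
  set V : ℝ := S + M * T with hV
  have hV0 : 0 ≤ V := by positivity
  set f : ℝ × ℝ → ℝ × ℝ := fun p => (max (-V) (min V p.2), g p.1) with hf
  have hfL : LipschitzWith (max 1 K) f := by
    have h1 : LipschitzWith 1 (fun p : ℝ × ℝ => max (-V) (min V p.2)) :=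
      (LipschitzWith.prod_snd.const_min V).const_max (-V)
    have h2 : LipschitzWith K (fun p : ℝ × ℝ => g p.1) := by
      have := hg.comp (LipschitzWith.prod_fst (α := ℝ) (β := ℝ))
      rw [mul_one] at this
      exact this
    exact h1.prodMk h2
  have hfb : ∀ p, ‖f p‖ ≤ V + M := by
    intro p
    rw [Prod.norm_def]
    apply max_le
    · have : |max (-V) (min V p.2)| ≤ V :=
        abs_le.2 ⟨le_max_left _ _, max_le (by linarith) (min_le_left _ _)⟩
      simp only [hf, Real.norm_eq_abs]
      linarith
    · have : |g p.1| ≤ M := abs_le.2 ⟨hgM _, (hg0 _).trans hM⟩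
      simp only [hf, Real.norm_eq_abs]
      linarith
  have hPL : IsPicardLindelof (fun _ : ℝ => f) (tmin := y0) (tmax := y1)
      ⟨y0, left_mem_Icc.2 hy.le⟩ (A, (0 : ℝ)) ⟨S + (V + M) * T, by positivity⟩ ⟨S, hS0⟩
      ⟨V + M, by positivity⟩ (max 1 K) := by
    refine IsPicardLindelof.of_time_independent (fun p _ => hfb p) hfL.lipschitzOnWith ?_
    change (V + M) * max (y1 - y0) (y0 - y0) ≤ S + (V + M) * T - S
    rw [sub_self, ← hT, max_eq_left hT0.le]
    linarith
  obtain ⟨α, hα, L', hL'⟩ :=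
    hPL.exists_forall_mem_closedBall_eq_hasDerivWithinAt_lipschitzOnWith
  have hmem : ∀ s ∈ Icc (-S) S, (A, s) ∈ Metric.closedBall (A, (0 : ℝ)) S := by
    intro s hs
    rw [Metric.mem_closedBall, Prod.dist_eq]
    simp [abs_le.2 hs]
  have h1 : ∀ s ∈ Icc (-S) S, (α (A, s) y0).1 = A ∧ (α (A, s) y0).2 = s := by
    intro s hs
    have := (hα _ (hmem s hs)).1
    simp only at this
    rw [this]; simp
  have hd2 : ∀ s ∈ Icc (-S) S, ∀ t ∈ Icc y0 y1,
      HasDerivWithinAt (fun t => (α (A, s) t).2) (g (α (A, s) t).1) (Icc y0 y1) t :=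
    fun s hs t ht => ((hα _ (hmem s hs)).2 t ht).snd
  have hv : ∀ s ∈ Icc (-S) S, ∀ t ∈ Icc y0 y1, s - M * T ≤ (α (A, s) t).2 ∧
      (α (A, s) t).2 ≤ s := by
    intro s hs t ht
    have e1 := aux_lower (c := -M) (hd2 s hs) (fun t _ => hgM _) ht
    have e2 := aux_upper (c := 0) (hd2 s hs) (fun t _ => hg0 _) ht
    simp only [(h1 s hs).2] at e1 e2
    have : M * (t - y0) ≤ M * T := mul_le_mul_of_nonneg_left (by linarith [ht.2]) hM
    constructor <;> linarith
  have hd1 : ∀ s ∈ Icc (-S) S, ∀ t ∈ Icc y0 y1,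
      HasDerivWithinAt (fun t => (α (A, s) t).1) ((α (A, s) t).2) (Icc y0 y1) t := by
    intro s hs t ht
    have h : HasDerivWithinAt (fun t => (α (A, s) t).1) (max (-V) (min V (α (A, s) t).2))
        (Icc y0 y1) t := ((hα _ (hmem s hs)).2 t ht).fst
    have e := hv s hs t ht
    have e' : max (-V) (min V (α (A, s) t).2) = (α (A, s) t).2 := by
      have : 0 ≤ M * T := by positivity
      rw [min_eq_right (by linarith [e.2, hs.2]), max_eq_right (by linarith [e.1, hs.1])]
    rwa [e'] at h
  have hy1 : y1 ∈ Icc y0 y1 := right_mem_Icc.2 hy.le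
  have hcont : ContinuousOn (fun s => (α (A, s) y1).1) (Icc (-S) S) := by
    refine continuous_fst.comp_continuousOn ?_
    exact (hL' y1 hy1).continuousOn.comp (f := fun s => (A, s)) (by fun_prop) hmem
  have hdiv : |B - A| / T * T = |B - A| := div_mul_cancel₀ _ hT0.ne'
  have hB : B ∈ Icc (α (A, -S) y1).1 (α (A, S) y1).1 := by
    have m1 : -S ∈ Icc (-S) S := ⟨le_rfl, by linarith⟩
    have m2 : S ∈ Icc (-S) S := ⟨by linarith, le_rfl⟩
    have e1 := aux_upper (c := -S) (hd1 _ m1) (fun t ht => (hv _ m1 t ht).2) hy1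
    have e2 := aux_lower (c := S - M * T) (hd1 _ m2) (fun t ht => (hv _ m2 t ht).1) hy1
    simp only [(h1 _ m1).1, (h1 _ m2).1] at e1 e2
    have e3 : S - M * T = |B - A| / T := by rw [hS]; ring
    rw [e3, ← hT, hdiv] at e2
    have e4 : -S * T ≤ - |B - A| := by
      have : 0 ≤ M * T * T := by positivity
      rw [hS, neg_mul, add_mul, hdiv]; linarith
    rw [← hT] at e1
    constructor
    · linarith [neg_abs_le (B - A)]
    · linarith [le_abs_self (B - A)]
  obtain ⟨s, hs, hsB⟩ := intermediate_value_Icc (by linarith) hcont hB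
  simp only at hsB
  set h := fun t => (α (A, s) t).1 with hh
  have hch : ContinuousOn h (Icc y0 y1) := fun t ht => (hd1 s hs t ht).continuousWithinAt
  set W : ℝ → ℝ := IccExtend hy.le ((Icc y0 y1).domRestrict (fun t => g (h t))) with hW
  have hWc : Continuous W := by
    apply Continuous.Icc_extend'
    exact (hg.continuous.comp_continuousOn hch).domRestrict
  have hWe : ∀ t ∈ Icc y0 y1, W t = g (h t) := by
    intro t ht
    rw [hW, IccExtend_of_mem _ _ ht]; rfl
  set H1 : ℝ → ℝ := fun u => s + ∫ t in y0..u, W t with hH1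
  have hH1d : ∀ y, HasDerivAt H1 (W y) y := fun y => aux_ftc hWc y0 s y
  have hH1c : Continuous H1 := continuous_iff_continuousAt.2 fun y => (hH1d y).continuousAt
  set H : ℝ → ℝ := fun u => A + ∫ t in y0..u, H1 t with hH
  have hHd : ∀ y, HasDerivAt H (H1 y) y := fun y => aux_ftc hH1c y0 A y
  have k1 : ∀ t ∈ Icc y0 y1, H1 t = (α (A, s) t).2 := fun t ht =>
    aux_eq (f' := fun t => g (h t)) (fun t ht => by
      rw [← hWe t ht]; exact (hH1d t).hasDerivWithinAt) (hd2 s hs)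
      (by simp [hH1, (h1 s hs).2]) ht
  have k0 : ∀ t ∈ Icc y0 y1, H t = h t := fun t ht =>
    aux_eq (f' := fun t => (α (A, s) t).2) (fun t ht => by
      rw [← k1 t ht]; exact (hHd t).hasDerivWithinAt) (hd1 s hs)
      (by simp [hH, (h1 s hs).1]) ht
  refine ⟨H, H1, W, hHd, hH1d, hWc, fun y => hg0 _, by simp [hH], ?_, ?_⟩
  · rw [k0 _ hy1]; exact hsB
  · intro y hy'
    rw [hWe y hy', k0 y hy']

/-- The profile function `h = x^7` as a function of `y`. -/
lemma exists_profile {A B y0 y1 : ℝ} (hA : 0 < A) (hB : 0 < B) (hy : y0 < y1) :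
    ∃ H H1 H2 : ℝ → ℝ, (∀ y, HasDerivAt H (H1 y) y) ∧ (∀ y, HasDerivAt H1 (H2 y) y) ∧
      Continuous H2 ∧ H y0 = A ∧ H y1 = B ∧
      ∀ y ∈ Icc y0 y1, 0 < H y ∧ H2 y = -(21 / 4) * (H y ^ (1 / 7 : ℝ))⁻¹ := by
  set m := min A B with hm
  have hm0 : 0 < m := lt_min hA hB
  set g : ℝ → ℝ := fun z => -(21 / 4) * (max z m) ^ (-(1 / 7) : ℝ) with hg
  have hmono : ∀ z, (max z m) ^ (-(1 / 7) : ℝ) ≤ m ^ (-(1 / 7) : ℝ) := fun z =>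
    Real.rpow_le_rpow_of_nonpos hm0 (le_max_right _ _) (by norm_num)
  have hpos : ∀ z, 0 ≤ (max z m) ^ (-(1 / 7) : ℝ) := fun z =>
    Real.rpow_nonneg (hm0.le.trans (le_max_right _ _)) _
  have hLip : ∃ K : NNReal, LipschitzWith K g := by
    obtain ⟨C, hC⟩ : ∃ C : NNReal, (C : ℝ) = (21 / 4) * ((1 / 7) * m ^ (-(1 / 7) - 1 : ℝ)) :=
      ⟨⟨_, by positivity⟩, rfl⟩
    have h1 : LipschitzOnWith C
        (fun z : ℝ => -(21 / 4) * z ^ (-(1 / 7) : ℝ)) (Ici m) := by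
      refine (convex_Ici m).lipschitzOnWith_of_nnnorm_hasDerivWithin_le
        (f' := fun z => -(21 / 4) * (-(1 / 7) * z ^ (-(1 / 7) - 1 : ℝ))) ?_ ?_
      · intro z hz
        have hz0 : 0 < z := hm0.trans_le hz
        exact ((Real.hasDerivAt_rpow_const (Or.inl hz0.ne')).const_mul _).hasDerivWithinAt
      · intro z hz
        have hz0 : 0 < z := hm0.trans_le hz
        rw [← NNReal.coe_le_coe, coe_nnnorm, hC]
        have h2 : z ^ (-(1 / 7) - 1 : ℝ) ≤ m ^ (-(1 / 7) - 1 : ℝ) :=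
          Real.rpow_le_rpow_of_nonpos hm0 hz (by norm_num)
        have h3 : 0 ≤ z ^ (-(1 / 7) - 1 : ℝ) := by positivity
        rw [Real.norm_eq_abs, abs_le]
        constructor <;> linarith
    have h2 : LipschitzWith 1 (fun z : ℝ => max z m) := LipschitzWith.id.max_const m
    have h3 := h1.comp (h2.lipschitzOnWith (s := univ)) (fun z _ => le_max_right z m)
    exact ⟨_, lipschitzOnWith_univ.1 h3⟩
  obtain ⟨K, hK⟩ := hLip
  obtain ⟨H, H1, H2, hH, hH1, hc, hn, h0, h1, he⟩ := bvp_exists hK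
    (M := (21 / 4) * m ^ (-(1 / 7) : ℝ))
    (fun z => by have := hmono z; simp only [hg]; linarith)
    (fun z => by have := hpos z; simp only [hg]; linarith) hy A B
  refine ⟨H, H1, H2, hH, hH1, hc, h0, h1, ?_⟩
  have dH : deriv H = H1 := funext fun y => (hH y).deriv
  have dH1 : deriv H1 = H2 := funext fun y => (hH1 y).deriv
  have hconc : ConcaveOn ℝ univ H := by
    refine concaveOn_univ_of_deriv2_nonpos (fun y => (hH y).differentiableAt) ?_ ?_
    · rw [dH]; exact fun y => (hH1 y).differentiableAt
    · intro y
      simp only [Function.iterate_succ, Function.iterate_zero, Function.comp, id, dH, dH1]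
      exact hn y
  intro y hy'
  have hmin := hconc.min_le_of_mem_Icc (mem_univ y0) (mem_univ y1) hy'
  rw [h0, h1, ← hm] at hmin
  have hpos : 0 < H y := hm0.trans_le hmin
  refine ⟨hpos, ?_⟩
  rw [he y hy', ← Real.rpow_neg hpos.le]
  simp only [hg, max_eq_left hmin]

lemma contDiff_two_of {f f' f'' : ℝ → ℝ} (h1 : ∀ t, HasDerivAt f (f' t) t)
    (h2 : ∀ t, HasDerivAt f' (f'' t) t) (h3 : Continuous f'') : ContDiff ℝ 2 f := by
  have e1 : deriv f = f' := funext fun t => (h1 t).deriv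
  have e2 : deriv f' = f'' := funext fun t => (h2 t).deriv
  rw [show (2 : WithTop ℕ∞) = 1 + 1 by norm_num, contDiff_succ_iff_deriv]
  refine ⟨fun t => (h1 t).differentiableAt, by simp, ?_⟩
  rw [e1, contDiff_one_iff_deriv, e2]
  exact ⟨fun t => (h2 t).differentiableAt, h3⟩

lemma derivs_of_contDiff_two {f : ℝ → ℝ} (hf : ContDiff ℝ 2 f) :
    (∀ t, HasDerivAt f (deriv f t) t) ∧ ∀ t, HasDerivAt (deriv f) (deriv (deriv f) t) t := by
  rw [show (2 : WithTop ℕ∞) = 1 + 1 by norm_num, contDiff_succ_iff_deriv] at hf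
  exact ⟨fun t => (hf.1 t).hasDerivAt, fun t =>
    ((hf.2.2.differentiable (by norm_num)) t).hasDerivAt⟩

/-- First integral of the geodesic equations. -/
lemma GeodSeg.first_integral {γ : ℝ → ℝ × ℝ} (hγ : GeodSeg γ) :
    ∃ x x' y : ℝ → ℝ, ∃ J : ℝ, (∀ t, γ t = (x t, y t)) ∧
      (∀ t ∈ Icc (0 : ℝ) 1, 0 < x t) ∧
      (∀ t, HasDerivAt x (x' t) t) ∧
      (∀ t ∈ Icc (0 : ℝ) 1, HasDerivAt x' (-(3 / 4) * J ^ 2 * x t ^ 5) t) ∧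
      (∀ t ∈ Icc (0 : ℝ) 1, HasDerivAt y (J * x t ^ 6) t) ∧
      ∃ c ∈ Ioo (0 : ℝ) 1, J * x c ^ 6 = y 1 - y 0 := by
  obtain ⟨hC, hpos, heq⟩ := hγ
  set x : ℝ → ℝ := fun s => (γ s).1 with hx
  set y : ℝ → ℝ := fun s => (γ s).2 with hy
  obtain ⟨hx1, hx2⟩ := derivs_of_contDiff_two (f := x) (contDiff_fst.comp hC)
  obtain ⟨hy1, hy2⟩ := derivs_of_contDiff_two (f := y) (contDiff_snd.comp hC)
  have hpos' : ∀ t ∈ Icc (0 : ℝ) 1, 0 < x t := hpos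
  have key : ∀ t ∈ Icc (0 : ℝ) 1, deriv y t = (deriv y 0 / x 0 ^ 6) * x t ^ 6 := by
    intro t ht
    have h := aux_eq (f := fun t => deriv y t / x t ^ 6) (g := fun _ => deriv y 0 / x 0 ^ 6)
      (f' := fun _ => 0) (a := 0) (b := 1) (fun t ht => by
        have hp := hpos' t ht
        have h1 := (hy2 t).div ((hx1 t).pow 6) (pow_ne_zero 6 hp.ne')
        refine HasDerivAt.hasDerivWithinAt ?_
        refine HasDerivAt.congr_deriv h1 ?_
        rw [(heq t ht).2]
        change (6 * (x t)⁻¹ * deriv x t * deriv y t * (x t) ^ 6 -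
          deriv y t * (_ * (x t) ^ (6 - 1) * deriv x t)) / ((x t) ^ 6) ^ 2 = (0 : ℝ)
        have : (x t)⁻¹ * x t ^ 6 = x t ^ 5 := by field_simp
        rw [show 6 * (x t)⁻¹ * deriv x t * deriv y t * (x t) ^ 6
          = 6 * deriv x t * deriv y t * ((x t)⁻¹ * x t ^ 6) by ring, this]
        push_cast
        ring) (fun t _ => hasDerivWithinAt_const _ _ _) rfl ht
    rw [← h, div_mul_cancel₀ _ (pow_ne_zero 6 (hpos' t ht).ne')]
  refine ⟨x, deriv x, y, deriv y 0 / x 0 ^ 6, fun t => rfl, hpos', hx1, ?_, ?_, ?_⟩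
  · intro t ht
    refine HasDerivAt.congr_deriv (hx2 t) ?_
    rw [(heq t ht).1]
    change -(3 / 4) * x t ^ (-7 : ℤ) * deriv y t ^ 2 = _
    rw [key t ht]
    have hp := hpos' t ht
    have : x t ^ (-7 : ℤ) * x t ^ 12 = x t ^ 5 := by
      rw [show (-7 : ℤ) = -((7 : ℕ) : ℤ) by norm_num, zpow_neg, zpow_natCast]
      field_simp
    rw [← this]; ring
  · intro t ht
    rw [← key t ht]; exact hy1 t
  · obtain ⟨c, hc, h⟩ := exists_hasDerivAt_eq_slope y (deriv y) (zero_lt_one)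
      (fun t _ => (hy1 t).continuousAt.continuousWithinAt) (fun t _ => hy1 t)
    refine ⟨c, hc, ?_⟩
    rw [← key c (Ioo_subset_Icc_self hc), h]; simp

/-- Uniqueness of the trajectory. -/
lemma trajectory_unique {H H1 H2 : ℝ → ℝ} {y0 y1 J : ℝ} {x x' y : ℝ → ℝ} (hJ : 0 < J)
    (hH : ∀ y, HasDerivAt H (H1 y) y) (hH1 : ∀ y, HasDerivAt H1 (H2 y) y)
    (hH2 : ∀ y ∈ Icc y0 y1, 0 < H y ∧ H2 y = -(21 / 4) * (H y ^ (1 / 7 : ℝ))⁻¹)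
    (hx0 : ∀ t ∈ Icc (0 : ℝ) 1, 0 < x t)
    (hx : ∀ t, HasDerivAt x (x' t) t)
    (hx' : ∀ t ∈ Icc (0 : ℝ) 1, HasDerivAt x' (-(3 / 4) * J ^ 2 * x t ^ 5) t)
    (hy : ∀ t ∈ Icc (0 : ℝ) 1, HasDerivAt y (J * x t ^ 6) t)
    (hyI : ∀ t ∈ Icc (0 : ℝ) 1, y t ∈ Icc y0 y1)
    (h0 : x 0 ^ 7 = H (y 0)) (h1 : x 1 ^ 7 = H (y 1)) :
    ∀ t ∈ Icc (0 : ℝ) 1, x t ^ 7 = H (y t) := by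
  set D : ℝ → ℝ := fun t => x t ^ 7 - H (y t) with hD
  set P : ℝ → ℝ := fun t => 7 * x' t - J * H1 (y t) with hP
  set Q : ℝ → ℝ := fun t => (21 / 4) * J ^ 2 * x t ^ 6 * ((H (y t) ^ (1 / 7 : ℝ))⁻¹ - (x t)⁻¹)
    with hQ
  have dD : ∀ t ∈ Icc (0 : ℝ) 1, HasDerivAt D (x t ^ 6 * P t) t := by
    intro t ht
    have := ((hx t).pow 7).sub ((hH (y t)).comp t (hy t ht))
    refine HasDerivAt.congr_deriv this ?_
    simp only [hP]; push_cast; ring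
  have dP : ∀ t ∈ Icc (0 : ℝ) 1, HasDerivAt P (Q t) t := by
    intro t ht
    have := ((hx' t ht).const_mul 7).sub (((hH1 (y t)).comp t (hy t ht)).const_mul J)
    refine HasDerivAt.congr_deriv this ?_
    rw [(hH2 _ (hyI t ht)).2]
    have hp := hx0 t ht
    have e : x t ^ 6 * (x t)⁻¹ = x t ^ 5 := by field_simp
    simp only [hQ]
    linear_combination ((21 / 4) * J ^ 2) * e
  have hQD : ∀ t ∈ Icc (0 : ℝ) 1, 0 ≤ D t * Q t := by
    intro t ht
    have hp := hx0 t ht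
    have hHp := (hH2 _ (hyI t ht)).1
    set r := H (y t) ^ (1 / 7 : ℝ) with hr
    have hr0 : 0 < r := by positivity
    have hr7 : r ^ 7 = H (y t) := by
      rw [hr, ← Real.rpow_natCast, ← Real.rpow_mul hHp.le]; norm_num
    simp only [hD, hQ, ← hr]
    rw [← hr7]
    have : 0 ≤ (x t ^ 7 - r ^ 7) * (r⁻¹ - (x t)⁻¹) := by
      rcases le_total r (x t) with h | h
      · exact mul_nonneg (sub_nonneg.2 (by gcongr)) (sub_nonneg.2 (by gcongr))
      · exact mul_nonneg_of_nonpos_of_nonpos (sub_nonpos.2 (by gcongr)) (sub_nonpos.2 (by gcongr))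
    have h2 : 0 ≤ (21 / 4) * J ^ 2 * x t ^ 6 := by positivity
    calc 0 ≤ ((21 / 4) * J ^ 2 * x t ^ 6) * ((x t ^ 7 - r ^ 7) * (r⁻¹ - (x t)⁻¹)) :=
          mul_nonneg h2 this
      _ = _ := by ring
  have dDP : ∀ t ∈ Icc (0 : ℝ) 1, HasDerivAt (fun t => D t * P t)
      (x t ^ 6 * P t * P t + D t * Q t) t := fun t ht => (dD t ht).mul (dP t ht)
  have hnn : ∀ t ∈ Icc (0 : ℝ) 1, 0 ≤ x t ^ 6 * P t * P t + D t * Q t := by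
    intro t ht
    have := hQD t ht
    have : 0 ≤ x t ^ 6 * (P t * P t) := mul_nonneg (by positivity) (mul_self_nonneg _)
    linarith
  have hmono : MonotoneOn (fun t => D t * P t) (Icc 0 1) :=
    monotoneOn_of_hasDerivWithinAt_nonneg (convex_Icc 0 1)
      (fun t ht => (dDP t ht).continuousAt.continuousWithinAt)
      (fun t ht => (dDP t (interior_subset ht)).hasDerivWithinAt)
      (fun t ht => hnn t (interior_subset ht))
  have hD0 : D 0 = 0 := by simp [hD, h0]
  have hD1 : D 1 = 0 := by simp [hD, h1]
  have hzero : ∀ t ∈ Icc (0 : ℝ) 1, D t * P t = 0 := by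
    intro t ht
    have e1 := hmono (left_mem_Icc.2 zero_le_one) ht ht.1
    have e2 := hmono ht (right_mem_Icc.2 zero_le_one) ht.2
    simp only [hD0, hD1, zero_mul] at e1 e2
    exact le_antisymm e2 e1
  intro t ht
  have h := aux_eq (f := fun t => D t ^ 2) (g := fun _ => 0) (f' := fun _ => 0) (a := 0) (b := 1)
    (fun t ht => by
      refine HasDerivAt.hasDerivWithinAt ?_
      refine HasDerivAt.congr_deriv ((dD t ht).pow 2) ?_
      have := hzero t ht
      push_cast
      linear_combination (2 * x t ^ 6) * this) (fun t _ => hasDerivWithinAt_const _ _ _)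
      (by simp [hD0]) ht
  have h' : D t = 0 := by simpa using h
  simp only [hD] at h'
  linarith

/-- The case of strictly increasing second coordinate. -/
lemma geod_case_pos (p q : ℝ × ℝ) (hp : 0 < p.1) (hq : 0 < q.1) (hlt : p.2 < q.2) :
    ∃ γ : ℝ → ℝ × ℝ, GeodSeg γ ∧ γ 0 = p ∧ γ 1 = q ∧
      ∀ γ' : ℝ → ℝ × ℝ, GeodSeg γ' → γ' 0 = p → γ' 1 = q →
        ∀ t ∈ Set.Icc (0 : ℝ) 1, γ' t = γ t := by
  obtain ⟨a, y0⟩ := p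
  obtain ⟨b, y1⟩ := q
  simp only at hp hq hlt
  obtain ⟨H, H1, H2, hH, hH1, hH2c, hHa, hHb, hH2⟩ :=
    exists_profile (pow_pos hp 7) (pow_pos hq 7) hlt
  have hHc : Continuous H := continuous_iff_continuousAt.2 fun y => (hH y).continuousAt
  have hH1c : Continuous H1 := continuous_iff_continuousAt.2 fun y => (hH1 y).continuousAt
  set r : ℝ → ℝ := fun y => H y ^ (1 / 7 : ℝ) with hr
  have hrc : Continuous r := hHc.rpow_const (fun _ => Or.inr (by norm_num))
  have hr0 : ∀ y ∈ Icc y0 y1, 0 < r y := fun y hy => Real.rpow_pos_of_pos (hH2 y hy).1 _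
  have hr7 : ∀ y ∈ Icc y0 y1, r y ^ 7 = H y := by
    intro y hy
    simp only [hr]
    rw [← Real.rpow_natCast, ← Real.rpow_mul (hH2 y hy).1.le]; norm_num
  have hroot : ∀ x, 0 < x → ∀ y ∈ Icc y0 y1, x ^ 7 = H y → x = r y := by
    intro x hx y hy h
    rw [← hr7 y hy] at h
    exact (pow_left_inj₀ hx.le (hr0 y hy).le (by norm_num)).1 h
  have m0 : y0 ∈ Icc y0 y1 := left_mem_Icc.2 hlt.le
  have m1 : y1 ∈ Icc y0 y1 := right_mem_Icc.2 hlt.le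
  -- the clamp
  set c : ℝ → ℝ := fun y => max y0 (min y y1) with hc
  have hcc : Continuous c := by fun_prop
  have hcI : ∀ y, c y ∈ Icc y0 y1 := fun y =>
    ⟨le_max_left _ _, max_le hlt.le (min_le_right _ _)⟩
  have hce : ∀ y ∈ Icc y0 y1, c y = y := fun y hy => by
    simp only [hc]; rw [min_eq_left hy.2, max_eq_right hy.1]
  set φ : ℝ → ℝ := fun y => (r (c y) ^ 6)⁻¹ with hφ
  have hφ0 : ∀ y, 0 < φ y := fun y => by
    have := hr0 _ (hcI y)
    simp only [hφ]; positivity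
  have hφc : Continuous φ :=
    ((hrc.comp hcc).pow 6).inv₀ (fun y => (pow_pos (hr0 _ (hcI y)) 6).ne')
  obtain ⟨δ, hδ, hδφ⟩ : ∃ δ > 0, ∀ y, δ ≤ φ y := by
    obtain ⟨z, hz, hmin⟩ := isCompact_Icc.exists_isMinOn ⟨y0, m0⟩ (hφc.continuousOn (s := Icc y0 y1))
    refine ⟨φ z, hφ0 z, fun y => ?_⟩
    have h1 : φ z ≤ φ (c y) := hmin (hcI y)
    have h2 : φ (c y) = φ y := by simp only [hφ]; rw [hce _ (hcI y)]
    rwa [h2] at h1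
  set τ : ℝ → ℝ := fun u => 0 + ∫ s in y0..u, φ s with hτ
  have hτd : ∀ y, HasDerivAt τ (φ y) y := fun y => aux_ftc hφc y0 0 y
  have hτ0 : τ y0 = 0 := by simp [hτ]
  have hτm : StrictMono τ := strictMono_of_deriv_pos fun y => by
    rw [(hτd y).deriv]; exact hφ0 y
  have hτc : Continuous τ := continuous_iff_continuousAt.2 fun y => (hτd y).continuousAt
  have hmono : Monotone (fun y => τ y - δ * y) := by
    have hd : ∀ y, HasDerivAt (fun y => τ y - δ * y) (φ y - δ * 1) y := fun y =>
      (hτd y).sub ((hasDerivAt_id y).const_mul δ)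
    refine monotone_of_deriv_nonneg (fun y => (hd y).differentiableAt) fun y => ?_
    rw [(hd y).deriv]; linarith [hδφ y]
  have hτs : Function.Surjective τ := by
    apply hτc.surjective
    · refine Filter.tendsto_atTop_mono' _ (f₁ := fun y => δ * y + -(δ * y0)) ?_ ?_
      · filter_upwards [Filter.eventually_ge_atTop y0] with y hy
        have := hmono hy
        simp only [hτ0] at this
        linarith
      · exact Filter.tendsto_atTop_add_const_right _ _ (Filter.tendsto_id.const_mul_atTop hδ)
    · refine Filter.tendsto_atBot_mono' _ (f₁ := fun y => δ * y + -(δ * y0)) ?_ ?_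
      · filter_upwards [Filter.eventually_le_atBot y0] with y hy
        have := hmono hy
        simp only [hτ0] at this
        linarith
      · exact Filter.tendsto_atBot_add_const_right _ _ (Filter.tendsto_id.const_mul_atBot hδ)
  set e : ℝ ≃o ℝ := StrictMono.orderIsoOfSurjective τ hτm hτs with he
  set Y : ℝ → ℝ := fun t => e.symm t with hY
  have hYτ : ∀ y, Y (τ y) = y := fun y => e.symm_apply_apply y
  have hτY : ∀ t, τ (Y t) = t := fun t => e.apply_symm_apply t
  have hYc : Continuous Y := e.symm.continuous
  have hYm : Monotone Y := e.symm.monotone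
  have hYd : ∀ t, HasDerivAt Y (φ (Y t))⁻¹ t := fun t =>
    HasDerivAt.of_local_left_inverse hYc.continuousAt (hτd (Y t)) (hφ0 _).ne'
      (Filter.Eventually.of_forall hτY)
  set J : ℝ := τ y1 with hJ
  have hJ0 : 0 < J := by rw [hJ, ← hτ0]; exact hτm hlt
  have hY0 : Y 0 = y0 := by rw [← hτ0, hYτ]
  have hYJ : Y J = y1 := by rw [hJ, hYτ]
  set Z : ℝ → ℝ := fun t => Y (J * t) with hZ
  have hZc : Continuous Z := by simp only [hZ]; fun_prop
  have hZd : ∀ t, HasDerivAt Z ((φ (Z t))⁻¹ * J) t := fun t => by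
    have h1 : HasDerivAt (fun t : ℝ => J * t) (J * 1) t := (hasDerivAt_id t).const_mul J
    rw [mul_one] at h1
    exact (hYd (J * t)).comp t h1
  have hZ0 : Z 0 = y0 := by simp only [hZ, mul_zero, hY0]
  have hZ1 : Z 1 = y1 := by simp only [hZ, mul_one, hYJ]
  have hZI : ∀ t ∈ Icc (0 : ℝ) 1, Z t ∈ Icc y0 y1 := fun t ht => by
    rw [← hZ0, ← hZ1]
    exact ⟨hYm (mul_le_mul_of_nonneg_left ht.1 hJ0.le),
      hYm (mul_le_mul_of_nonneg_left ht.2 hJ0.le)⟩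
  have hφI : ∀ y ∈ Icc y0 y1, (φ y)⁻¹ = r y ^ 6 := fun y hy => by
    simp only [hφ]; rw [hce y hy, inv_inv]
  -- the curve
  set v : ℝ → ℝ := fun t => J / 7 * H1 (Z t) with hv
  set w : ℝ → ℝ := fun t => J / 7 * (H2 (Z t) * ((φ (Z t))⁻¹ * J)) with hw
  have hvd : ∀ t, HasDerivAt v (w t) t := fun t =>
    ((hH1 (Z t)).comp t (hZd t)).const_mul (J / 7)
  have hvc : Continuous v := continuous_iff_continuousAt.2 fun y => (hvd y).continuousAt
  have hwc : Continuous w :=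
    continuous_const.mul ((hH2c.comp hZc).mul
      (((hφc.comp hZc).inv₀ (fun t => (hφ0 (Z t)).ne')).mul continuous_const))
  set X : ℝ → ℝ := fun t => a + ∫ s in (0 : ℝ)..t, v s with hX
  have hXd : ∀ t, HasDerivAt X (v t) t := fun t => aux_ftc hvc 0 a t
  have hXc : Continuous X := continuous_iff_continuousAt.2 fun y => (hXd y).continuousAt
  set y : ℝ → ℝ := fun t => y0 + ∫ s in (0 : ℝ)..t, J * X s ^ 6 with hy
  have hyd : ∀ t, HasDerivAt y (J * X t ^ 6) t := fun t =>
    aux_ftc (W := fun t => J * X t ^ 6) (by fun_prop) 0 y0 t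
  have hydd : ∀ t, HasDerivAt (fun t => J * X t ^ 6) (J * (6 * X t ^ 5 * v t)) t := fun t =>
    ((hXd t).pow 6).const_mul J
  have hXr : ∀ t ∈ Icc (0 : ℝ) 1, X t = r (Z t) := by
    intro t ht
    refine aux_eq (a := 0) (b := 1) (f' := v) (g := fun t => r (Z t)) (fun t _ => (hXd t).hasDerivWithinAt) ?_ ?_ ht
    · intro t ht
      have hI := hZI t ht
      have hpos := (hH2 _ hI).1
      have h1 : HasDerivAt (fun t => H (Z t)) (H1 (Z t) * ((φ (Z t))⁻¹ * J)) t :=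
        (hH (Z t)).comp t (hZd t)
      have h2 : HasDerivAt (fun t => r (Z t)) _ t :=
        h1.rpow_const (p := 1 / 7) (Or.inl hpos.ne')
      refine (h2.congr_deriv ?_).hasDerivWithinAt
      have h3 : H (Z t) ^ (1 / 7 - 1 : ℝ) = (r (Z t) ^ 6)⁻¹ := by
        simp only [hr]
        rw [← Real.rpow_natCast, ← Real.rpow_mul hpos.le, ← Real.rpow_neg hpos.le]
        norm_num
      rw [h3, hφI _ hI]
      have := hr0 _ hI
      simp only [hv]
      field_simp
    · rw [hZ0]
      have : X 0 = a := by simp [hX]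
      rw [this]
      exact hroot a hp y0 m0 hHa.symm
  have hyZ : ∀ t ∈ Icc (0 : ℝ) 1, y t = Z t := by
    intro t ht
    refine aux_eq (a := 0) (b := 1) (f' := fun t => J * X t ^ 6)
      (fun t _ => (hyd t).hasDerivWithinAt) ?_ ?_ ht
    · intro t ht
      refine ((hZd t).congr_deriv ?_).hasDerivWithinAt
      rw [hφI _ (hZI t ht), hXr t ht]; ring
    · rw [hZ0]; simp [hy]
  have t0 : (0 : ℝ) ∈ Icc (0 : ℝ) 1 := left_mem_Icc.2 zero_le_one
  have t1 : (1 : ℝ) ∈ Icc (0 : ℝ) 1 := right_mem_Icc.2 zero_le_one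
  refine ⟨fun t => (X t, y t), ⟨?_, ?_, ?_⟩, ?_, ?_, ?_⟩
  · exact (contDiff_two_of hXd hvd hwc).prodMk
      (contDiff_two_of hyd hydd (by fun_prop))
  · intro t ht
    simp only
    rw [hXr t ht]; exact hr0 _ (hZI t ht)
  · intro t ht
    have hpos : 0 < X t := by rw [hXr t ht]; exact hr0 _ (hZI t ht)
    have dX : deriv X = v := funext fun t => (hXd t).deriv
    have dy : deriv y = fun t => J * X t ^ 6 := funext fun t => (hyd t).deriv
    change deriv (deriv X) t = -(3 / 4) * X t ^ (-7 : ℤ) * (deriv y t) ^ 2 ∧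
      deriv (deriv y) t = 6 * (X t)⁻¹ * deriv X t * deriv y t
    rw [dX, dy, (hvd t).deriv, (hydd t).deriv]
    constructor
    · simp only [hw]
      rw [(hH2 _ (hZI t ht)).2, hφI _ (hZI t ht)]
      change J / 7 * (-(21 / 4) * (r (Z t))⁻¹ * (r (Z t) ^ 6 * J)) = _
      rw [← hXr t ht, show (-7 : ℤ) = -((7 : ℕ) : ℤ) by norm_num, zpow_neg, zpow_natCast]
      field_simp
      norm_num
    · field_simp
  · simp [hX, hy]
  · simp only [hXr 1 t1, hyZ 1 t1, hZ1]
    rw [← hroot b hq y1 m1 hHb.symm]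
  · intro γ' hγ' h0 h1
    obtain ⟨x, x', z, K, hγe, hx0, hx, hx', hz, s, hs, hsK⟩ := hγ'.first_integral
    rw [hγe, Prod.mk.injEq] at h0 h1
    have hK0 : 0 < K := by
      rw [h0.2, h1.2] at hsK
      have hxs := pow_pos (hx0 s (Ioo_subset_Icc_self hs)) 6
      exact pos_of_mul_pos_left (by rw [hsK]; linarith) hxs.le
    have hzm : MonotoneOn z (Icc 0 1) :=
      monotoneOn_of_hasDerivWithinAt_nonneg (convex_Icc 0 1)
        (fun t ht => (hz t ht).continuousAt.continuousWithinAt)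
        (fun t ht => (hz t (interior_subset ht)).hasDerivWithinAt)
        (fun t ht => by
          have := hx0 t (interior_subset ht)
          positivity)
    have hzI : ∀ t ∈ Icc (0 : ℝ) 1, z t ∈ Icc y0 y1 := fun t ht => by
      rw [← h0.2, ← h1.2]
      exact ⟨hzm t0 ht ht.1, hzm ht t1 ht.2⟩
    have htr := trajectory_unique hK0 hH hH1 hH2 hx0 hx hx' hz hzI
      (by rw [h0.1, h0.2, hHa]) (by rw [h1.1, h1.2, hHb])
    have hxr : ∀ t ∈ Icc (0 : ℝ) 1, x t = r (z t) := fun t ht =>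
      hroot _ (hx0 t ht) _ (hzI t ht) (htr t ht)
    have hτz : ∀ t ∈ Icc (0 : ℝ) 1, τ (z t) = K * t := by
      intro t ht
      refine aux_eq (a := 0) (b := 1) (f' := fun _ => K) (f := fun t => τ (z t))
        (g := fun t => K * t) ?_ ?_ ?_ ht
      · intro t ht
        refine (((hτd (z t)).comp t (hz t ht)).congr_deriv ?_).hasDerivWithinAt
        have h3 := hφI _ (hzI t ht)
        rw [← hxr t ht] at h3
        rw [← h3]
        have := (hφ0 (z t)).ne'
        field_simp
      · intro t _
        simpa using ((hasDerivAt_id t).const_mul K).hasDerivWithinAt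
      · simp [h0.2, hτ0]
    have hKJ : K = J := by
      have := hτz 1 t1
      rw [h1.2] at this
      simpa using this.symm
    intro t ht
    have hzZ : z t = Z t := by
      have h3 := hτz t ht
      simp only [hZ]
      rw [← hKJ, ← h3, hYτ]
    change γ' t = (X t, y t)
    rw [hγe t, hxr t ht, hXr t ht, hyZ t ht, hzZ]

/-- The degenerate case of equal second coordinates. -/
lemma geod_case_eq (p q : ℝ × ℝ) (hp : 0 < p.1) (hq : 0 < q.1) (heq : p.2 = q.2) :
    ∃ γ : ℝ → ℝ × ℝ, GeodSeg γ ∧ γ 0 = p ∧ γ 1 = q ∧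
      ∀ γ' : ℝ → ℝ × ℝ, GeodSeg γ' → γ' 0 = p → γ' 1 = q →
        ∀ t ∈ Set.Icc (0 : ℝ) 1, γ' t = γ t := by
  obtain ⟨a, y0⟩ := p
  obtain ⟨b, y1⟩ := q
  simp only at hp hq heq
  subst heq
  have hl : ∀ c t : ℝ, HasDerivAt (fun t => a + c * t) c t := fun c t => by
    simpa using ((hasDerivAt_id t).const_mul c).const_add a
  have t1 : (1 : ℝ) ∈ Icc (0 : ℝ) 1 := right_mem_Icc.2 zero_le_one
  refine ⟨fun t => (a + (b - a) * t, y0), ⟨?_, ?_, ?_⟩, by simp, by simp, ?_⟩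
  · fun_prop
  · intro t ht
    simp only
    have h2 : 0 ≤ 1 - t := by linarith [ht.2]
    rcases ht.1.eq_or_lt with h | h
    · rw [← h]; simpa using hp
    · have : 0 < b * t := by positivity
      have : 0 ≤ a * (1 - t) := by positivity
      linarith
  · intro t _
    have dX : deriv (fun t => a + (b - a) * t) = fun _ => b - a :=
      funext fun t => (hl (b - a) t).deriv
    simp [dX]
  · intro γ' hγ' h0 h1
    obtain ⟨x, x', z, K, hγe, hx0, hx, hx', hz, s, hs, hsK⟩ := hγ'.first_integral
    rw [hγe, Prod.mk.injEq] at h0 h1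
    have hK0 : K = 0 := by
      rw [h0.2, h1.2, sub_self] at hsK
      exact (mul_eq_zero.1 hsK).resolve_right
        (pow_pos (hx0 s (Ioo_subset_Icc_self hs)) 6).ne'
    subst hK0
    have e1 : ∀ t ∈ Icc (0 : ℝ) 1, z t = y0 := fun t ht =>
      aux_eq (a := 0) (b := 1) (f' := fun _ => 0) (g := fun _ => y0)
        (fun t ht => by simpa using (hz t ht).hasDerivWithinAt)
        (fun t _ => hasDerivWithinAt_const _ _ _) h0.2 ht
    have e2 : ∀ t ∈ Icc (0 : ℝ) 1, x' t = x' 0 := fun t ht =>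
      aux_eq (a := 0) (b := 1) (f' := fun _ => 0) (g := fun _ => x' 0)
        (fun t ht => by simpa using (hx' t ht).hasDerivWithinAt)
        (fun t _ => hasDerivWithinAt_const _ _ _) rfl ht
    have e3 : ∀ t ∈ Icc (0 : ℝ) 1, x t = a + x' 0 * t := fun t ht =>
      aux_eq (a := 0) (b := 1) (f' := fun _ => x' 0) (g := fun t => a + x' 0 * t)
        (fun t ht => by rw [← e2 t ht]; exact (hx t).hasDerivWithinAt)
        (fun t _ => (hl _ t).hasDerivWithinAt) (by simp [h0.1]) ht
    have e4 : x' 0 = b - a := by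
      have := e3 1 t1
      rw [h1.1] at this
      linarith
    intro t ht
    rw [hγe, e1 t ht, e3 t ht, e4]

/-- Reflection in the second coordinate. -/
lemma GeodSeg.reflect {γ : ℝ → ℝ × ℝ} (hγ : GeodSeg γ) :
    GeodSeg (fun t => ((γ t).1, -(γ t).2)) := by
  obtain ⟨hC, hpos, heq⟩ := hγ
  refine ⟨(contDiff_fst.comp hC).prodMk (contDiff_snd.comp hC).neg, hpos, ?_⟩
  intro t ht
  have d : deriv (fun s => -(γ s).2) = fun s => -deriv (fun s => (γ s).2) s :=
    funext fun s => deriv.fun_neg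
  have d2 : deriv (fun s => -deriv (fun s => (γ s).2) s) t = -deriv (deriv fun s => (γ s).2) t :=
    deriv.fun_neg
  simp only
  rw [d, d2, (heq t ht).1, (heq t ht).2]
  constructor <;> ring

/-- (ℝ_{>0}×ℝ, 4dx² + x⁻⁶dy²) is geodesically convex: any two
points are joined by a geodesic segment, unique (on [0,1]) among such segments. -/
theorem stmt14 (p q : ℝ × ℝ) (hp : 0 < p.1) (hq : 0 < q.1) :
    ∃ γ : ℝ → ℝ × ℝ, GeodSeg γ ∧ γ 0 = p ∧ γ 1 = q ∧
      ∀ γ' : ℝ → ℝ × ℝ, GeodSeg γ' → γ' 0 = p → γ' 1 = q →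
        ∀ t ∈ Set.Icc (0 : ℝ) 1, γ' t = γ t := by
  rcases lt_trichotomy p.2 q.2 with h | h | h
  · exact geod_case_pos p q hp hq h
  · exact geod_case_eq p q hp hq h
  · obtain ⟨γ, hγ, h0, h1, hu⟩ := geod_case_pos (p.1, -p.2) (q.1, -q.2) hp hq (neg_lt_neg h)
    refine ⟨_, hγ.reflect, by simp [h0], by simp [h1], ?_⟩
    intro γ' hγ' h0' h1' t ht
    have := hu _ hγ'.reflect (by simp [h0']) (by simp [h1']) t ht
    rw [← this]
    simp
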